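/- Let C be a small ℂ-linear category, n ≥ 1, and ψ ∈ CN^n(C) with bψ ∈ C^{n+1}_λ(C). Set φ := Bψ ∈ Z^{n−1}_λ(C), and let (S, ∂̂, T̂, ρ) be an (n−1)-dimensional cycle over C whose character is φ. Define Sφ ∈ CN^{n+1}(C) by (Sφ)(f⁰⊗…⊗f^{n+1}) := Σ_{j=1}^{n} T̂(ρ(f⁰)∘∂̂ρ(f¹)∘…∘∂̂ρ(f^{j−1})∘ρ(f^j f^{j+1})∘∂̂ρ(f^{j+2})∘…∘∂̂ρ(f^{n+1})) (the image of φ under the periodicity operator S). Then S(Bψ) = n(n+1)·bψ in H^{n+1}_λ(C); that is, there exists ζ ∈ C^n_λ(C) with Sφ − n(n+1)bψ = bζ. -/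

import Mathlib

open CategoryTheory

noncomputable section

namespace CFM

universe v u u₁ v₁

variable (C : Type u) [Category.{v} C]

/-- A composable chain of morphisms `(f⁰, f¹, …, fⁿ)` with `fⁱ : Xᵢ₊₁ ⟶ Xᵢ`;
`Chain C X Y` consists of chains with innermost source `X` and outermost target `Y`;
`f⁰` is the outermost morphism. -/
inductive Chain : C → C → Type (max u v)
  | single : {X Y : C} → (X ⟶ Y) → Chain X Y
  | cons : {X Y Z : C} → (Y ⟶ Z) → Chain X Y → Chain X Z

namespace Chain

variable {C}

/-- Number of morphisms in the chain. -/
def size : {X Y : C} → Chain C X Y → ℕ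
  | _, _, single _ => 1
  | _, _, cons _ c => c.size + 1

theorem one_le_size {X Y : C} (c : Chain C X Y) : 1 ≤ c.size := by
  induction c with
  | single f => simp [size]
  | cons f c ih => simp [size]

/-- Append a morphism at the inner end of a chain. -/
def snoc : {V X Y : C} → Chain C X Y → (V ⟶ X) → Chain C V Y
  | _, _, _, single f, g => cons f (single g)
  | _, _, _, cons f c, g => cons f (snoc c g)

/-- Compose the morphisms in slots `i` and `i+1` of the chain (`fⁱ ∘ fⁱ⁺¹`). -/
def composeAt : {X Y : C} → ℕ → Chain C X Y → Chain C X Y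
  | _, _, _, single f => single f
  | _, _, 0, cons f (single g) => single (g ≫ f)
  | _, _, 0, cons f (cons g c) => cons (g ≫ f) c
  | _, _, (i+1), cons f c => cons f (composeAt i c)

end Chain

/-- A cyclically composable tuple `(f⁰, …, fⁿ)`, i.e. an element of the cyclic nerve:
a chain from some object back to itself. -/
def CycChain := Σ X : C, Chain C X X

/-- A function on the cyclic nerve of `C`; an element of `CN^n(C)` is (the multilinear
extension of) such a function, evaluated on tuples of size `n+1`. -/
def Cochain := CycChain C → ℂ

variable {C}

/-- The inverse cyclic rotation `(f⁰, …, fⁿ) ↦ (f¹, …, fⁿ, f⁰)`. -/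
def rotInv : CycChain C → CycChain C
  | ⟨X, Chain.single f⟩ => ⟨X, Chain.single f⟩
  | ⟨_, Chain.cons f c⟩ => ⟨_, c.snoc f⟩

/-- The cyclic rotation `(f⁰, …, fⁿ) ↦ (fⁿ, f⁰, …, fⁿ⁻¹)`. -/
def rot (t : CycChain C) : CycChain C := rotInv^[t.2.size - 1] t

/-- The (unsigned) cyclic operator: `(τφ)(f⁰⊗…⊗fⁿ) = φ(fⁿ⊗f⁰⊗…⊗fⁿ⁻¹)`. -/
def tauOp (φ : Cochain C) : Cochain C := fun t => φ (rot t)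

/-- The signed cyclic operator `λₙ = (-1)ⁿ τₙ` on `CN^n(C)`. -/
def lamOp (n : ℕ) (φ : Cochain C) : Cochain C := fun t => (-1 : ℂ) ^ n * φ (rot t)

/-- The operator `A = 1 + λₙ + λₙ² + ⋯ + λₙⁿ` on `CN^n(C)`. -/
def AOp (n : ℕ) (φ : Cochain C) : Cochain C :=
  fun t => ∑ k ∈ Finset.range (n + 1), (-1 : ℂ) ^ (n * k) * φ (rot^[k] t)

/-- The Hochschild coboundary `b : CN^n(C) → CN^{n+1}(C)`:
`(bφ)(f⁰⊗…⊗fⁿ⁺¹) = Σᵢ (-1)ⁱ φ(f⁰⊗…⊗fⁱfⁱ⁺¹⊗…⊗fⁿ⁺¹) + (-1)ⁿ⁺¹ φ(fⁿ⁺¹f⁰⊗f¹⊗…⊗fⁿ)`. -/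
def bOp (n : ℕ) (φ : Cochain C) : Cochain C := fun t =>
  (∑ i ∈ Finset.range (n + 1), (-1 : ℂ) ^ i * φ ⟨t.1, Chain.composeAt i t.2⟩) +
    (-1 : ℂ) ^ (n + 1) * φ ⟨(rot t).1, Chain.composeAt 0 (rot t).2⟩

/-- The truncated Hochschild coboundary `b'` (the last, cyclic, face omitted). -/
def b'Op (n : ℕ) (φ : Cochain C) : Cochain C := fun t =>
  ∑ i ∈ Finset.range (n + 1), (-1 : ℂ) ^ i * φ ⟨t.1, Chain.composeAt i t.2⟩

/-- The operator `B₀ : CN^{n+1}(C) → CN^n(C)`: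
`(B₀φ)(f⁰⊗…⊗fⁿ) = φ(id⊗f⁰⊗…⊗fⁿ) - (-1)ⁿ⁺¹ φ(f⁰⊗…⊗fⁿ⊗id)`. -/
def B0Op (n : ℕ) (φ : Cochain C) : Cochain C := fun t =>
  φ ⟨t.1, Chain.cons (𝟙 t.1) t.2⟩ - (-1 : ℂ) ^ (n + 1) * φ ⟨t.1, t.2.snoc (𝟙 t.1)⟩

/-- Connes' operator `B = A ∘ B₀ : CN^{n+1}(C) → CN^n(C)`. -/
def BOp (n : ℕ) (φ : Cochain C) : Cochain C := AOp n (B0Op n φ)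

/-- Additivity and ℂ-homogeneity of a cochain in the outermost (0-th) slot. -/
def MultilinAt0 [Preadditive C] [CategoryTheory.Linear ℂ C] (φ : Cochain C) : Prop :=
  (∀ {X Y : C} (f g : Y ⟶ X) (c : Chain C X Y),
      φ ⟨X, Chain.cons (f + g) c⟩ = φ ⟨X, Chain.cons f c⟩ + φ ⟨X, Chain.cons g c⟩) ∧
  (∀ {X Y : C} (a : ℂ) (f : Y ⟶ X) (c : Chain C X Y),
      φ ⟨X, Chain.cons (a • f) c⟩ = a * φ ⟨X, Chain.cons f c⟩) ∧
  (∀ {X : C} (f g : X ⟶ X),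
      φ ⟨X, Chain.single (f + g)⟩ = φ ⟨X, Chain.single f⟩ + φ ⟨X, Chain.single g⟩) ∧
  (∀ {X : C} (a : ℂ) (f : X ⟶ X),
      φ ⟨X, Chain.single (a • f)⟩ = a * φ ⟨X, Chain.single f⟩)

/-- A function on the cyclic nerve is a genuine cochain (an element of the dual
`CN^•(C)` of the cyclic nerve) iff it is ℂ-multilinear in every slot. -/
def IsCochain [Preadditive C] [CategoryTheory.Linear ℂ C] (φ : Cochain C) : Prop :=
  ∀ k : ℕ, MultilinAt0 fun t => φ (rotInv^[k] t)

/-- A differential graded semicategory over ℂ: hom-spaces are non-negatively graded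
cochain complexes of ℂ-vector spaces, with a bilinear associative composition that is a
map of complexes (graded Leibniz rule).  Composition carries a proof `i + j = k` to
avoid dependent rewriting of degrees. -/
structure DGSemicat where
  Obj : Type u₁
  Hom : Obj → Obj → ℕ → Type v₁
  [acg : ∀ X Y n, AddCommGroup (Hom X Y n)]
  [mod : ∀ X Y n, Module ℂ (Hom X Y n)]
  comp : ∀ {X Y Z : Obj} {i j k : ℕ}, i + j = k → Hom Y Z i → Hom X Y j → Hom X Z k
  comp_add_left : ∀ {X Y Z : Obj} {i j k : ℕ} (h : i + j = k) (g g' : Hom Y Z i)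
    (f : Hom X Y j), comp h (g + g') f = comp h g f + comp h g' f
  comp_add_right : ∀ {X Y Z : Obj} {i j k : ℕ} (h : i + j = k) (g : Hom Y Z i)
    (f f' : Hom X Y j), comp h g (f + f') = comp h g f + comp h g f'
  comp_smul_left : ∀ {X Y Z : Obj} {i j k : ℕ} (h : i + j = k) (a : ℂ) (g : Hom Y Z i)
    (f : Hom X Y j), comp h (a • g) f = a • comp h g f
  comp_smul_right : ∀ {X Y Z : Obj} {i j k : ℕ} (h : i + j = k) (a : ℂ) (g : Hom Y Z i)
    (f : Hom X Y j), comp h g (a • f) = a • comp h g f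
  comp_assoc : ∀ {W X Y Z : Obj} {i j k s t u : ℕ}
    (h₁ : i + j = s) (h₂ : s + k = t) (h₃ : j + k = u) (h₄ : i + u = t)
    (g : Hom Y Z i) (f : Hom X Y j) (e : Hom W X k),
    comp h₂ (comp h₁ g f) e = comp h₄ g (comp h₃ f e)
  d : ∀ {X Y : Obj} {n : ℕ}, Hom X Y n → Hom X Y (n + 1)
  d_add : ∀ {X Y : Obj} {n : ℕ} (f g : Hom X Y n), d (f + g) = d f + d g
  d_smul : ∀ {X Y : Obj} {n : ℕ} (a : ℂ) (f : Hom X Y n), d (a • f) = a • d f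
  d_sq : ∀ {X Y : Obj} {n : ℕ} (f : Hom X Y n), d (d f) = 0
  leibniz : ∀ {X Y Z : Obj} {i j k : ℕ} (h : i + j = k) (h₁ : (i + 1) + j = k + 1)
    (h₂ : i + (j + 1) = k + 1) (g : Hom Y Z i) (f : Hom X Y j),
    d (comp h g f) = comp h₁ (d g) f + ((-1 : ℂ) ^ i) • comp h₂ g (d f)

attribute [instance] DGSemicat.acg DGSemicat.mod

/-- An `r`-dimensional cycle `(S, ∂̂, T̂, ρ)` over a small ℂ-linear category `C`:
a DG-semicategory `S` whose degree-0 part is an ordinary category (with identities `one`),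
an `r`-dimensional closed graded trace `tr`, and a ℂ-linear semifunctor `ρ : C → S⁰`. -/
structure CycleOver.{u', v', u₁', v₁'} (C : Type u') [Category.{v'} C] [Preadditive C]
    [CategoryTheory.Linear ℂ C] (r : ℕ) where
  S : DGSemicat.{u₁', v₁'}
  one : ∀ X, S.Hom X X 0
  one_comp : ∀ {X Y} (f : S.Hom X Y 0), S.comp rfl (one Y) f = f
  comp_one : ∀ {X Y} (f : S.Hom X Y 0), S.comp rfl f (one X) = f
  tr : ∀ X, S.Hom X X r →ₗ[ℂ] ℂ
  tr_closed : ∀ {X : S.Obj} {k : ℕ} (hk : k + 1 = r) (f : S.Hom X X k),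
    tr X (hk ▸ S.d f) = 0
  tr_graded : ∀ {X Y : S.Obj} {i j : ℕ} (h : i + j = r) (h' : j + i = r)
    (g : S.Hom Y X i) (g' : S.Hom X Y j),
    tr X (S.comp h g g') = ((-1 : ℂ) ^ (i * j)) * tr Y (S.comp h' g' g)
  ρObj : C → S.Obj
  ρMap : ∀ {X Y : C}, (X ⟶ Y) → S.Hom (ρObj X) (ρObj Y) 0
  ρMap_comp : ∀ {X Y Z : C} (f : X ⟶ Y) (g : Y ⟶ Z),
    ρMap (f ≫ g) = S.comp rfl (ρMap g) (ρMap f)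
  ρMap_add : ∀ {X Y : C} (f g : X ⟶ Y), ρMap (f + g) = ρMap f + ρMap g
  ρMap_smul : ∀ {X Y : C} (a : ℂ) (f : X ⟶ Y), ρMap (a • f) = a • ρMap f

variable {C : Type u} [Category.{v} C] [Preadditive C] [CategoryTheory.Linear ℂ C] {r : ℕ}

/-- Transport a homogeneous morphism along an equality of degrees. -/
def degCast {S : DGSemicat.{u₁', v₁'}} {X Y : S.Obj} {a b : ℕ} (h : a = b)
    (f : S.Hom X Y a) : S.Hom X Y b := h ▸ f

/-- `∂̂ρ(f⁰) ∘ ∂̂ρ(f¹) ∘ ⋯ ∘ ∂̂ρ(fⁿ)` along a chain (an element of degree `size`). -/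
def prodD (Z : CycleOver.{u, v, u₁, v₁} C r) :
    (X Y : C) → (c : Chain C X Y) → Z.S.Hom (Z.ρObj X) (Z.ρObj Y) c.size
  | _, _, Chain.single f => degCast (by simp only [Chain.size]) (Z.S.d (Z.ρMap f))
  | _, _, Chain.cons f c => Z.S.comp (by simp only [Chain.size]; omega)
      (Z.S.d (Z.ρMap f)) (prodD Z _ _ c)

/-- `ρ(f⁰) ∘ ∂̂ρ(f¹) ∘ ⋯ ∘ ∂̂ρ(fⁿ)` along a chain (degree `size - 1`). -/
def charEl (Z : CycleOver.{u, v, u₁, v₁} C r) :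
    (X Y : C) → (c : Chain C X Y) → Z.S.Hom (Z.ρObj X) (Z.ρObj Y) (c.size - 1)
  | _, _, Chain.single f => degCast (by simp only [Chain.size]) (Z.ρMap f)
  | _, _, Chain.cons f c => Z.S.comp (by simp only [Chain.size]; omega)
      (Z.ρMap f) (prodD Z _ _ c)

/-- `∂̂ρ(f⁰) ⋯ ρ(fʲ) ⋯ ∂̂ρ(fⁿ)`: all slots differentiated except slot `j`
(degree `size - 1`). -/
def prodDExcept (Z : CycleOver.{u, v, u₁, v₁} C r) :
    (X Y : C) → (c : Chain C X Y) → ℕ → Z.S.Hom (Z.ρObj X) (Z.ρObj Y) (c.size - 1)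
  | _, _, Chain.single f, _ => degCast (by simp only [Chain.size]) (Z.ρMap f)
  | _, _, Chain.cons f c, 0 => Z.S.comp (by simp only [Chain.size]; omega)
      (Z.ρMap f) (prodD Z _ _ c)
  | _, _, Chain.cons f c, (j+1) => Z.S.comp
      (by simp only [Chain.size]; have := Chain.one_le_size c; omega)
      (Z.S.d (Z.ρMap f)) (prodDExcept Z _ _ c j)

/-- `ρ(f⁰) ∂̂ρ(f¹) ⋯ ρ(fʲ) ⋯ ∂̂ρ(fⁿ)`: slot `0` and slot `j` undifferentiated, all other
slots differentiated (degree `size - 2`). -/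
def psiEl (Z : CycleOver.{u, v, u₁, v₁} C r) :
    (X Y : C) → (c : Chain C X Y) → ℕ → Z.S.Hom (Z.ρObj X) (Z.ρObj Y) (c.size - 2)
  | _, _, Chain.single f, _ => degCast (by simp only [Chain.size]) (Z.ρMap f)
  | _, _, Chain.cons f c, j => Z.S.comp (by simp only [Chain.size]; omega)
      (Z.ρMap f) (prodDExcept Z _ _ c (j - 1))

/-- The character `φ ∈ CN^r(C)` of an `r`-dimensional cycle:
`φ(f⁰⊗…⊗f^r) = T̂(ρ(f⁰) ∂̂ρ(f¹) ⋯ ∂̂ρ(f^r))`. -/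
noncomputable def charCochain (Z : CycleOver.{u, v, u₁, v₁} C r) : Cochain C := fun t =>
  if h : t.2.size - 1 = r then Z.tr (Z.ρObj t.1) (h ▸ charEl Z _ _ t.2) else 0

/-- `T̂(ρ(f⁰) ∂̂ρ(f¹) ⋯ ρ(fʲ) ⋯ ∂̂ρ(fⁿ))` (defined when the degree matches `r`). -/
noncomputable def trPsi (Z : CycleOver.{u, v, u₁, v₁} C r) {X : C} (c : Chain C X X)
    (j : ℕ) : ℂ :=
  if h : c.size - 2 = r then Z.tr (Z.ρObj X) (h ▸ psiEl Z _ _ c j) else 0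

/-- The cochain `ψ ∈ CN^{r+1}(C)` of Proposition `S(φ) = bψ`:
`ψ(f⁰⊗…⊗f^{r+1}) = Σ_{j=1}^{r+1} (-1)^{j-1} T̂(ρ(f⁰)∂̂ρ(f¹)⋯ρ(fʲ)⋯∂̂ρ(f^{r+1}))`. -/
noncomputable def psiCochain (Z : CycleOver.{u, v, u₁, v₁} C r) : Cochain C := fun t =>
  ∑ j ∈ Finset.Icc 1 (r + 1), (-1 : ℂ) ^ (j - 1) * trPsi Z t.2 j

/-- The image `Sφ ∈ CN^{r+2}(C)` of the character `φ` of an `r`-dimensional cycle under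
the periodicity operator:
`(Sφ)(f⁰⊗…⊗f^{r+2}) = Σ_{j=1}^{r+1} T̂(ρ(f⁰)∂̂ρ(f¹)⋯∂̂ρ(f^{j-1}) ρ(fʲf^{j+1}) ∂̂ρ(f^{j+2})⋯∂̂ρ(f^{r+2}))`. -/
noncomputable def SCochain (Z : CycleOver.{u, v, u₁, v₁} C r) : Cochain C := fun t =>
  ∑ j ∈ Finset.Icc 1 (r + 1), trPsi Z (Chain.composeAt j t.2) j

section Chains

variable {𝒟 : Type u} [Category.{v} 𝒟]

namespace Chain

/-- Concatenation of chains, the outer one first. -/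
def append : {X Y W : 𝒟} → Chain 𝒟 Y W → Chain 𝒟 X Y → Chain 𝒟 X W
  | _, _, _, single f, d => cons f d
  | _, _, _, cons f c, d => cons f (append c d)

theorem append_assoc {V X Y W : 𝒟} (a : Chain 𝒟 Y W) (b : Chain 𝒟 X Y) (c : Chain 𝒟 V X) :
    (a.append b).append c = a.append (b.append c) := by
  induction a with
  | single f => simp [append]
  | cons f a ih => simp [append, ih]

theorem snoc_eq_append {V X Y : 𝒟} (c : Chain 𝒟 X Y) (f : V ⟶ X) :
    c.snoc f = c.append (single f) := by
  induction c with
  | single g => simp [append, snoc]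
  | cons g c ih => simp [append, snoc, ih]

theorem size_append {V X Y : 𝒟} (c : Chain 𝒟 X Y) (d : Chain 𝒟 V X) :
    (c.append d).size = c.size + d.size := by
  induction c with
  | single g => simp [append, size, add_comm]
  | cons g c ih => simp [append, size, ih]; omega

theorem size_snoc {V X Y : 𝒟} (c : Chain 𝒟 X Y) (f : V ⟶ X) :
    (c.snoc f).size = c.size + 1 := by
  simp [snoc_eq_append, size_append, size]

theorem size_composeAt {X Y : 𝒟} (c : Chain 𝒟 X Y) (i : ℕ) (h : i + 1 < c.size) :
    (c.composeAt i).size + 1 = c.size := by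
  induction c generalizing i with
  | single f => simp [size] at h
  | cons f c ih =>
    cases i with
    | zero => cases c <;> simp [composeAt, size]
    | succ i => simp only [size] at h; simp [composeAt, size, ih i (by omega)]

theorem exists_snoc {X Y : 𝒟} (c : Chain 𝒟 X Y) (h : 2 ≤ c.size) :
    ∃ (V : 𝒟) (c' : Chain 𝒟 V Y) (f : X ⟶ V), c = c'.snoc f := by
  induction c with
  | single f => simp [size] at h
  | cons f c ih =>
    cases c with
    | single g => exact ⟨_, single f, g, by simp [snoc]⟩
    | cons g c =>
      obtain ⟨V, c', l, hl⟩ := ih (by have := c.one_le_size; simp [size]; omega)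
      exact ⟨V, cons f c', l, by simp [hl, snoc]⟩

theorem composeAt_snoc {V X Y : 𝒟} (c : Chain 𝒟 X Y) (f : V ⟶ X) (i : ℕ)
    (h : i + 1 < c.size) : (c.snoc f).composeAt i = (c.composeAt i).snoc f := by
  induction c generalizing i with
  | single g => simp [size] at h
  | cons g c ih =>
    cases i with
    | zero => cases c <;> simp [composeAt, snoc]
    | succ i =>
      simp only [size] at h
      simp [composeAt, snoc, ih i (by omega)]

theorem composeAt_snoc_snoc {V W X Y : 𝒟} (c : Chain 𝒟 X Y) (f : V ⟶ X) (g : W ⟶ V) :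
    ((c.snoc f).snoc g).composeAt c.size = c.snoc (g ≫ f) := by
  induction c with
  | single h => simp [composeAt, snoc, size]
  | cons h c ih => simp [composeAt, snoc, size, ih]

theorem composeAt_snoc_id {X Y : 𝒟} (c : Chain 𝒟 X Y) :
    (c.snoc (𝟙 X)).composeAt (c.size - 1) = c := by
  induction c with
  | single h => simp [composeAt, snoc, size]
  | cons h c ih =>
    obtain ⟨k, hk⟩ : ∃ k, c.size = k + 1 := ⟨c.size - 1, by have := c.one_le_size; omega⟩
    simp only [hk, Nat.add_sub_cancel] at ih
    simp [composeAt, snoc, size, hk, ih]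

theorem composeAt_zero_cons_id {X Y : 𝒟} (c : Chain 𝒟 X Y) :
    (cons (𝟙 Y) c).composeAt 0 = c := by
  cases c <;> simp [composeAt]

theorem composeAt_composeAt {X Y : 𝒟} (c : Chain 𝒟 X Y) (i j : ℕ) (hij : i ≤ j) :
    (c.composeAt (j + 1)).composeAt i = (c.composeAt i).composeAt j := by
  induction c generalizing i j with
  | single f => simp [composeAt]
  | cons f c ih =>
    cases i with
    | zero =>
      cases c with
      | single g => cases j <;> simp [composeAt]
      | cons g c =>
        cases j with
        | zero => cases c <;> simp [composeAt]
        | succ j => simp [composeAt]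
    | succ i =>
      obtain ⟨j, rfl⟩ : ∃ k, j = k + 1 := ⟨j - 1, by omega⟩
      simp [composeAt, ih i j (by omega)]

end Chain

namespace CycChain

/-- The cyclic chain given by a chain from an object to itself. -/
def of {X : 𝒟} (c : Chain 𝒟 X X) : CycChain 𝒟 := ⟨X, c⟩

/-- Number of morphisms in a cyclic chain. -/
def len (t : CycChain 𝒟) : ℕ := t.2.size

theorem exists_eq_of (t : CycChain 𝒟) : ∃ (X : 𝒟) (c : Chain 𝒟 X X), t = of c := ⟨t.1, t.2, rfl⟩

theorem len_of {X : 𝒟} (c : Chain 𝒟 X X) : (of c).len = c.size := rfl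

theorem rotInv_cons {X Y : 𝒟} (f : Y ⟶ X) (c : Chain 𝒟 X Y) :
    rotInv (of (Chain.cons f c)) = of (c.snoc f) := rfl

theorem len_rotInv (t : CycChain 𝒟) : (rotInv t).len = t.len := by
  obtain ⟨X, c, rfl⟩ := t.exists_eq_of
  cases c with
  | single f => rfl
  | cons f c => simp [rotInv_cons, len_of, Chain.size_snoc, Chain.size]

theorem len_rotInv_iterate (k : ℕ) (t : CycChain 𝒟) : (rotInv^[k] t).len = t.len := by
  induction k generalizing t with
  | zero => rfl
  | succ k ih => rw [Function.iterate_succ_apply, ih, len_rotInv]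

theorem len_rot (t : CycChain 𝒟) : (rot t).len = t.len := len_rotInv_iterate _ t

theorem rotInv_iterate_append {X Y : 𝒟} (c : Chain 𝒟 Y X) (d : Chain 𝒟 X Y) :
    rotInv^[c.size] (of (c.append d)) = of (d.append c) := by
  induction c with
  | single f => simp [Chain.size, Chain.append, rotInv_cons, Chain.snoc_eq_append]
  | cons f c ih =>
    rw [Chain.size, Function.iterate_succ_apply, Chain.append, rotInv_cons, Chain.snoc_eq_append,
      Chain.append_assoc, ih, Chain.append_assoc, Chain.append]

theorem rot_eq (t : CycChain 𝒟) : rot t = rotInv^[t.len - 1] t := rfl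

theorem rot_snoc {X Y : 𝒟} (c : Chain 𝒟 Y X) (f : X ⟶ Y) :
    rot (of (c.snoc f)) = of (Chain.cons f c) := by
  rw [rot_eq, Chain.snoc_eq_append, len_of, Chain.size_append, Chain.size, Nat.add_sub_cancel,
    rotInv_iterate_append, Chain.append]

theorem rot_cons_snoc {X Y Z : 𝒟} (f : Z ⟶ X) (c : Chain 𝒟 Y Z) (g : X ⟶ Y) :
    rot (of (Chain.cons f (c.snoc g))) = of (Chain.cons g (Chain.cons f c)) := by
  simpa only [Chain.snoc] using rot_snoc (Chain.cons f c) g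

theorem rot_cons_single {X Y : 𝒟} (f : Y ⟶ X) (g : X ⟶ Y) :
    rot (of (Chain.cons f (Chain.single g))) = of (Chain.cons g (Chain.single f)) := by
  simpa only [Chain.snoc] using rot_snoc (Chain.single f) g

theorem rot_single {X : 𝒟} (f : X ⟶ X) : rot (of (Chain.single f)) = of (Chain.single f) := by
  rw [rot_eq, len_of, Chain.size]; rfl

/-- The inner face maps of the cyclic nerve. -/
def face (i : ℕ) (t : CycChain 𝒟) : CycChain 𝒟 := of (t.2.composeAt i)

theorem face_of {X : 𝒟} (i : ℕ) (c : Chain 𝒟 X X) : face i (of c) = of (c.composeAt i) := rfl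

theorem len_face (t : CycChain 𝒟) (i : ℕ) (h : i + 1 < t.len) :
    (face i t).len + 1 = t.len := Chain.size_composeAt _ _ h

theorem face_face (t : CycChain 𝒟) {i j : ℕ} (h : i ≤ j) :
    face i (face (j + 1) t) = face j (face i t) := by
  obtain ⟨X, c, rfl⟩ := t.exists_eq_of
  simp only [face_of, Chain.composeAt_composeAt _ _ _ h]

theorem face_succ_rot (t : CycChain 𝒟) (i : ℕ) (h : i + 2 < t.len) :
    face (i + 1) (rot t) = rot (face i t) := by
  obtain ⟨X, c, rfl⟩ := t.exists_eq_of
  obtain ⟨V, c, f, rfl⟩ := c.exists_snoc (by rw [len_of] at h; omega)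
  simp only [len_of, Chain.size_snoc] at h
  rw [rot_snoc, face_of, face_of, Chain.composeAt_snoc _ _ _ (by omega), rot_snoc, Chain.composeAt]

theorem face_zero_rot_rot (t : CycChain 𝒟) (h : 2 ≤ t.len) :
    face 0 (rot (rot t)) = rot (face (t.len - 2) t) := by
  obtain ⟨X, c, rfl⟩ := t.exists_eq_of
  obtain ⟨V, c, f, rfl⟩ := c.exists_snoc h
  by_cases hc : 2 ≤ c.size
  · obtain ⟨W, c, g, rfl⟩ := c.exists_snoc hc
    rw [rot_snoc, rot_cons_snoc, len_of, Chain.size_snoc, Chain.size_snoc,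
      show c.size + 1 + 1 - 2 = c.size from rfl, face_of, face_of, Chain.composeAt_snoc_snoc,
      rot_snoc, Chain.composeAt]
  · cases c with
    | single g =>
      rw [rot_snoc, rot_cons_single, face_of, face_of, Chain.composeAt, len_of, Chain.snoc,
        Chain.size, Chain.size, Chain.composeAt, rot_single]
    | cons g c => exact absurd (by have := c.one_le_size; simp [Chain.size]; omega) hc

/-- All face maps of the cyclic nerve, the last one being the cyclic face. -/
def cycFace (i : ℕ) (t : CycChain 𝒟) : CycChain 𝒟 :=
  if i + 1 = t.len then face 0 (rot t) else face i t

theorem cycFace_of_eq {i : ℕ} {t : CycChain 𝒟} (h : i + 1 = t.len) :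
    cycFace i t = face 0 (rot t) := if_pos h

theorem cycFace_of_ne {i : ℕ} {t : CycChain 𝒟} (h : i + 1 ≠ t.len) :
    cycFace i t = face i t := if_neg h

theorem len_face_zero_rot (t : CycChain 𝒟) (h : 2 ≤ t.len) :
    (face 0 (rot t)).len + 1 = t.len := by
  rw [len_face _ _ (by rw [len_rot]; omega), len_rot]

theorem len_cycFace (t : CycChain 𝒟) (i : ℕ) (h : i < t.len) (h2 : 2 ≤ t.len) :
    (cycFace i t).len + 1 = t.len := by
  by_cases hi : i + 1 = t.len
  · rw [cycFace_of_eq hi, len_face_zero_rot t h2]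
  · rw [cycFace_of_ne hi, len_face _ _ (by omega)]

theorem cycFace_cycFace (t : CycChain 𝒟) {i j : ℕ} (hij : i ≤ j) (hj : j + 2 ≤ t.len)
    (h3 : 3 ≤ t.len) :
    cycFace i (cycFace (j + 1) t) = cycFace j (cycFace i t) := by
  have hs := len_face t i (by omega)
  have hs' := len_face_zero_rot t (by omega)
  rw [cycFace_of_ne (show i + 1 ≠ t.len by omega)]
  by_cases hj' : j + 2 = t.len
  · rw [cycFace_of_eq (show j + 1 + 1 = t.len by omega), cycFace_of_eq (i := j) (by omega)]
    by_cases hi' : i + 2 = t.len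
    · rw [cycFace_of_eq (by omega), ← face_succ_rot _ 0 (by rw [len_rot]; omega),
        show i = t.len - 2 by omega, ← face_zero_rot_rot _ (by omega), face_face _ le_rfl]
    · rw [cycFace_of_ne (by omega), ← face_succ_rot _ i (by omega), face_face _ (Nat.zero_le i)]
  · have hs'' := len_face t (j + 1) (by omega)
    rw [cycFace_of_ne (show j + 1 + 1 ≠ t.len by omega), cycFace_of_ne (by omega),
      cycFace_of_ne (by omega), face_face _ hij]

end CycChain

open CycChain

/-- The Hochschild coboundary, on plain functions. -/
def hochschild (n : ℕ) (χ : CycChain 𝒟 → ℂ) (t : CycChain 𝒟) : ℂ :=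
  (∑ i ∈ Finset.range (n + 1), (-1 : ℂ) ^ i * χ (face i t)) +
    (-1 : ℂ) ^ (n + 1) * χ (face 0 (rot t))

/-- The truncated Hochschild coboundary, on plain functions. -/
def truncHochschild (n : ℕ) (χ : CycChain 𝒟 → ℂ) (t : CycChain 𝒟) : ℂ :=
  ∑ i ∈ Finset.range (n + 1), (-1 : ℂ) ^ i * χ (face i t)

/-- The signed cyclic operator, on plain functions. -/
def signedRot (n : ℕ) (χ : CycChain 𝒟 → ℂ) (t : CycChain 𝒟) : ℂ := (-1 : ℂ) ^ n * χ (rot t)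

/-- The operator `A`, on plain functions. -/
def cyclicNorm (n : ℕ) (χ : CycChain 𝒟 → ℂ) (t : CycChain 𝒟) : ℂ :=
  ∑ k ∈ Finset.range (n + 1), (-1 : ℂ) ^ (n * k) * χ (rot^[k] t)

/-- The operator `B₀`, on plain functions. -/
def insertId (n : ℕ) (χ : CycChain 𝒟 → ℂ) (t : CycChain 𝒟) : ℂ :=
  χ (of (Chain.cons (𝟙 t.1) t.2)) - (-1 : ℂ) ^ (n + 1) * χ (of (t.2.snoc (𝟙 t.1)))

theorem neg_one_pow_mul_self (n : ℕ) : (-1 : ℂ) ^ n * (-1) ^ n = 1 := by rw [← mul_pow]; simp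

theorem hochschild_eq_sum_cycFace (n : ℕ) (χ : CycChain 𝒟 → ℂ) (t : CycChain 𝒟)
    (ht : t.len = n + 2) :
    hochschild n χ t = ∑ i ∈ Finset.range (n + 2), (-1 : ℂ) ^ i * χ (cycFace i t) := by
  rw [Finset.sum_range_succ, hochschild]
  congr 1
  · refine Finset.sum_congr rfl fun i hi => ?_
    rw [cycFace_of_ne (by simp at hi; omega)]
  · rw [cycFace_of_eq (by omega)]

theorem sum_alternating_eq_zero (n : ℕ) (F : ℕ → ℕ → ℂ)
    (hF : ∀ i j, i ≤ j → j ≤ n → F i (j + 1) = F j i) :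
    ∑ j ∈ Finset.range (n + 2), ∑ i ∈ Finset.range (n + 1),
      (-1 : ℂ) ^ j * ((-1) ^ i * F i j) = 0 := by
  rw [← Finset.sum_product']
  refine Finset.sum_involution
    (fun p _ => if p.2 < p.1 then (p.2, p.1 - 1) else (p.2 + 1, p.1)) ?_ ?_ ?_ ?_
  · rintro ⟨j, i⟩ hp
    simp only [Finset.mem_product, Finset.mem_range] at hp
    dsimp only
    split_ifs with h
    · obtain ⟨j, rfl⟩ : ∃ k, j = k + 1 := ⟨j - 1, by omega⟩
      simp only [Nat.add_sub_cancel]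
      rw [hF i j (by omega) (by omega)]
      ring
    · rw [hF j i (by omega) (by omega)]
      ring
  · rintro ⟨j, i⟩ hp _ h
    dsimp only at h
    split_ifs at h with h' <;> simp only [Prod.mk.injEq] at h <;> omega
  · rintro ⟨j, i⟩ hp
    simp only [Finset.mem_product, Finset.mem_range] at hp ⊢
    split_ifs with h <;> simp only <;> omega
  · rintro ⟨j, i⟩ hp
    by_cases h : i < j
    · simp only [h, if_true, show ¬ j - 1 < i by omega, if_false, Prod.mk.injEq, and_true]
      omega
    · simp only [h, if_false, show j < i + 1 by omega, if_true, Nat.add_sub_cancel]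

theorem hochschild_hochschild (n : ℕ) (χ : CycChain 𝒟 → ℂ) (t : CycChain 𝒟) (ht : t.len = n + 3) :
    hochschild (n + 1) (hochschild n χ) t = 0 := by
  rw [hochschild_eq_sum_cycFace _ _ _ ht,
    ← sum_alternating_eq_zero (n + 1) fun i j => χ (cycFace i (cycFace j t))]
  · refine Finset.sum_congr rfl fun j hj => ?_
    have := len_cycFace t j (by simp at hj; omega) (by omega)
    rw [hochschild_eq_sum_cycFace _ _ _ (by omega), Finset.mul_sum]
  · intro i j hij hj
    rw [cycFace_cycFace t hij (by omega) (by omega)]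

theorem truncHochschild_sub_signedRot (n : ℕ) (χ : CycChain 𝒟 → ℂ) (t : CycChain 𝒟)
    (ht : t.len = n + 2) :
    truncHochschild n (fun s => χ s - signedRot n χ s) t =
      hochschild n χ t - signedRot (n + 1) (hochschild n χ) t := by
  have h1 : ∑ i ∈ Finset.range n, (-1 : ℂ) ^ (i + 1) * χ (face (i + 1) (rot t)) =
      -∑ i ∈ Finset.range n, (-1 : ℂ) ^ i * χ (rot (face i t)) := by
    rw [← Finset.sum_neg_distrib]
    refine Finset.sum_congr rfl fun i hi => ?_
    rw [face_succ_rot _ _ (by simp at hi; omega)]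
    ring
  have h2 : face 0 (rot (rot t)) = rot (face n t) := by
    rw [face_zero_rot_rot _ (by omega), ht]; rfl
  have h3 : ∑ i ∈ Finset.range (n + 1), (-1 : ℂ) ^ i * ((-1) ^ n * χ (rot (face i t))) =
      (-1) ^ n * ∑ i ∈ Finset.range (n + 1), (-1 : ℂ) ^ i * χ (rot (face i t)) := by
    rw [Finset.mul_sum]
    exact Finset.sum_congr rfl fun i _ => by ring
  simp only [truncHochschild, hochschild, signedRot, mul_sub, Finset.sum_sub_distrib]
  rw [h3, h2, Finset.sum_range_succ' (fun i => (-1 : ℂ) ^ i * χ (face i (rot t))), h1,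
    Finset.sum_range_succ (fun i => (-1 : ℂ) ^ i * χ (rot (face i t)))]
  ring

theorem truncHochschild_insertId (n : ℕ) (ψ : CycChain 𝒟 → ℂ)
    (hbψ : ∀ t : CycChain 𝒟, t.len = n + 3 →
      signedRot (n + 2) (hochschild (n + 1) ψ) t = hochschild (n + 1) ψ t)
    (t : CycChain 𝒟) (ht : t.len = n + 2) :
    truncHochschild n (insertId n ψ) t = ψ t - signedRot (n + 1) ψ t := by
  obtain ⟨X, c, rfl⟩ := t.exists_eq_of
  rw [len_of] at ht
  have key := hbψ (of (c.snoc (𝟙 X))) (by rw [len_of, Chain.size_snoc, ht])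
  obtain ⟨V, d, l, hd⟩ := c.exists_snoc (by omega)
  have e0 : hochschild (n + 1) ψ (of (Chain.cons (𝟙 X) c)) =
      ψ (of c) -
        ∑ i ∈ Finset.range (n + 1), (-1 : ℂ) ^ i * ψ (of (Chain.cons (𝟙 X) (c.composeAt i)))
        + (-1 : ℂ) ^ (n + 2) * ψ (rot (of c)) := by
    have hr : face 0 (rot (of (Chain.cons (𝟙 X) c))) = rot (of c) := by
      rw [hd, rot_cons_snoc, rot_snoc, face_of, Chain.composeAt, Category.id_comp]
    rw [hochschild, hr, Finset.sum_range_succ']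
    simp only [face_of, Chain.composeAt_zero_cons_id, Chain.composeAt, pow_succ, mul_neg, mul_one,
      neg_mul, Finset.sum_neg_distrib, pow_zero, one_mul]
    ring
  have e1 : hochschild (n + 1) ψ (of (c.snoc (𝟙 X))) =
      ∑ i ∈ Finset.range (n + 1), (-1 : ℂ) ^ i * ψ (of ((c.composeAt i).snoc (𝟙 X))) := by
    have hl := c.composeAt_snoc_id
    rw [ht] at hl
    have hsum : ∑ i ∈ Finset.range (n + 1), (-1 : ℂ) ^ i * ψ (of ((c.snoc (𝟙 X)).composeAt i)) =
        ∑ i ∈ Finset.range (n + 1), (-1 : ℂ) ^ i * ψ (of ((c.composeAt i).snoc (𝟙 X))) := by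
      refine Finset.sum_congr rfl fun i hi => ?_
      rw [Chain.composeAt_snoc _ _ _ (by simp at hi; omega)]
    rw [hochschild, rot_snoc, Finset.sum_range_succ]
    simp only [face_of, Chain.composeAt_zero_cons_id]
    rw [hsum, show n + 1 = n + 2 - 1 from rfl, hl]
    simp only [Nat.add_one_sub_one, pow_succ]
    ring
  rw [signedRot, rot_snoc, e0, e1] at key
  have e2 : truncHochschild n (insertId n ψ) (of c) =
      ∑ i ∈ Finset.range (n + 1), (-1 : ℂ) ^ i * ψ (of (Chain.cons (𝟙 X) (c.composeAt i))) +
      (-1 : ℂ) ^ n *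
        ∑ i ∈ Finset.range (n + 1), (-1 : ℂ) ^ i * ψ (of ((c.composeAt i).snoc (𝟙 X))) := by
    have (i : ℕ) : insertId n ψ (face i (of c)) = ψ (of (Chain.cons (𝟙 X) (c.composeAt i))) -
        (-1) ^ (n + 1) * ψ (of ((c.composeAt i).snoc (𝟙 X))) := rfl
    rw [Finset.mul_sum, ← Finset.sum_add_distrib]
    refine Finset.sum_congr rfl fun i _ => ?_
    rw [this, pow_succ]
    ring
  rw [e2, ← key, signedRot]
  simp only [pow_succ]
  linear_combination (ψ (of c) -
    ∑ i ∈ Finset.range (n + 1), (-1 : ℂ) ^ i * ψ (of (Chain.cons (𝟙 X) (c.composeAt i))) +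
    (-1) ^ n * ψ (rot (of c))) * neg_one_pow_mul_self n

theorem sum_pow_rot_sub (n k : ℕ) (χ : CycChain 𝒟 → ℂ) (t : CycChain 𝒟) :
    (∑ i ∈ Finset.range k, (-1 : ℂ) ^ (n * i) * χ (rot^[i] t)) -
      (-1) ^ n * ∑ i ∈ Finset.range k, (-1 : ℂ) ^ (n * i) * χ (rot^[i] (rot t)) =
    χ t - (-1) ^ (n * k) * χ (rot^[k] t) := by
  induction k with
  | zero => simp
  | succ k ih =>
    rw [Finset.sum_range_succ, Finset.sum_range_succ, Function.iterate_succ_apply, Nat.mul_succ,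
      pow_add]
    linear_combination ih

/-- A cochain `ψ₁` with `(1 - λₙ) ψ₁ = A χ - (n + 1) χ`. -/
def rotPrimitive (n : ℕ) (χ : CycChain 𝒟 → ℂ) (t : CycChain 𝒟) : ℂ :=
  -∑ k ∈ Finset.range (n + 1), ∑ i ∈ Finset.range k, (-1 : ℂ) ^ (n * i) * χ (rot^[i] t)

theorem rotPrimitive_sub_signedRot (n : ℕ) (χ : CycChain 𝒟 → ℂ) (t : CycChain 𝒟) :
    rotPrimitive n χ t - signedRot n (rotPrimitive n χ) t = cyclicNorm n χ t - (n + 1) * χ t := by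
  have : rotPrimitive n χ t - signedRot n (rotPrimitive n χ) t =
      -∑ k ∈ Finset.range (n + 1), (χ t - (-1) ^ (n * k) * χ (rot^[k] t)) := by
    simp only [← sum_pow_rot_sub, Finset.sum_sub_distrib, ← Finset.mul_sum, signedRot, rotPrimitive]
    ring
  rw [this, Finset.sum_sub_distrib, cyclicNorm]
  simp

end Chains

section Multilinear

variable {𝒟 : Type u} [Category.{v} 𝒟] [Preadditive 𝒟] [CategoryTheory.Linear ℂ 𝒟]

open CycChain

/-- Three chains that agree except in one slot, where the third one has `a • f + g` for the
entries `f` and `g` of the first two. -/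
inductive LinRel (a : ℂ) : {X Y : 𝒟} → Chain 𝒟 X Y → Chain 𝒟 X Y → Chain 𝒟 X Y → Prop
  | single {X Y : 𝒟} (f g : X ⟶ Y) :
      LinRel a (Chain.single f) (Chain.single g) (Chain.single (a • f + g))
  | head {X Y Z : 𝒟} (f g : Y ⟶ Z) (c : Chain 𝒟 X Y) :
      LinRel a (Chain.cons f c) (Chain.cons g c) (Chain.cons (a • f + g) c)
  | tail {X Y Z : 𝒟} (f : Y ⟶ Z) {c₁ c₂ c₃ : Chain 𝒟 X Y} (h : LinRel a c₁ c₂ c₃) :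
      LinRel a (Chain.cons f c₁) (Chain.cons f c₂) (Chain.cons f c₃)

namespace LinRel

variable {a : ℂ}

theorem size_eq {X Y : 𝒟} {c₁ c₂ c₃ : Chain 𝒟 X Y} (h : LinRel a c₁ c₂ c₃) :
    c₁.size = c₃.size ∧ c₂.size = c₃.size := by
  induction h with
  | single f g => simp [Chain.size]
  | head f g c => simp [Chain.size]
  | tail f h ih => simpa [Chain.size] using ih

theorem snoc {V X Y : 𝒟} {c₁ c₂ c₃ : Chain 𝒟 X Y} (h : LinRel a c₁ c₂ c₃) (f : V ⟶ X) :
    LinRel a (c₁.snoc f) (c₂.snoc f) (c₃.snoc f) := by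
  induction h with
  | single g g' => simpa only [Chain.snoc] using head g g' _
  | head g g' c => simpa only [Chain.snoc] using head g g' _
  | tail g h ih => simpa only [Chain.snoc] using tail g ih

theorem snoc_right {V X Y : 𝒟} (c : Chain 𝒟 X Y) (f g : V ⟶ X) :
    LinRel a (c.snoc f) (c.snoc g) (c.snoc (a • f + g)) := by
  induction c with
  | single h => simpa only [Chain.snoc] using tail h (single f g)
  | cons h c ih => simpa only [Chain.snoc] using tail h ih

theorem composeAt {X Y : 𝒟} {c₁ c₂ c₃ : Chain 𝒟 X Y} (h : LinRel a c₁ c₂ c₃) (i : ℕ) :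
    LinRel a (c₁.composeAt i) (c₂.composeAt i) (c₃.composeAt i) := by
  induction h generalizing i with
  | single f g => simpa only [Chain.composeAt] using single f g
  | head f g c =>
    cases i with
    | zero =>
      cases c with
      | single h =>
        simpa only [Chain.composeAt, Preadditive.comp_add, Linear.comp_smul] using
          single (h ≫ f) (h ≫ g)
      | cons h c =>
        simpa only [Chain.composeAt, Preadditive.comp_add, Linear.comp_smul] using
          head (h ≫ f) (h ≫ g) c
    | succ i => simpa only [Chain.composeAt] using head f g _
  | tail f h ih =>
    cases i with
    | zero =>
      cases h with
      | single g g' =>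
        simpa only [Chain.composeAt, Preadditive.add_comp, Linear.smul_comp] using
          single (g ≫ f) (g' ≫ f)
      | head g g' c =>
        simpa only [Chain.composeAt, Preadditive.add_comp, Linear.smul_comp] using
          head (g ≫ f) (g' ≫ f) c
      | tail g h => simpa only [Chain.composeAt] using tail (g ≫ f) h
    | succ i => simpa only [Chain.composeAt] using tail f (ih i)

/-- The slot in which the chains differ can be rotated to the front. -/
theorem exists_rotInv {X : 𝒟} {c₁ c₂ c₃ : Chain 𝒟 X X} (h : LinRel a c₁ c₂ c₃) :
    (∃ f g : X ⟶ X, c₁ = Chain.single f ∧ c₂ = Chain.single g ∧ c₃ = Chain.single (a • f + g)) ∨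
    ∃ (k : ℕ) (Y Z : 𝒟) (f g : Y ⟶ Z) (c : Chain 𝒟 Z Y),
      of c₁ = rotInv^[k] (of (Chain.cons f c)) ∧ of c₂ = rotInv^[k] (of (Chain.cons g c)) ∧
      of c₃ = rotInv^[k] (of (Chain.cons (a • f + g) c)) := by
  have key : ∀ {W X' : 𝒟} {d₁ d₂ d₃ : Chain 𝒟 W X'}, LinRel a d₁ d₂ d₃ → ∀ p : Chain 𝒟 X' W,
      ∃ (k : ℕ) (Y Z : 𝒟) (f g : Y ⟶ Z) (c : Chain 𝒟 Z Y),
        of (p.append d₁) = rotInv^[k] (of (Chain.cons f c)) ∧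
        of (p.append d₂) = rotInv^[k] (of (Chain.cons g c)) ∧
        of (p.append d₃) = rotInv^[k] (of (Chain.cons (a • f + g) c)) := by
    intro W X' d₁ d₂ d₃ h
    induction h with
    | single f g =>
      intro p
      have e (x) : of (p.append (Chain.single x)) = rotInv^[1] (of (Chain.cons x p)) := by
        rw [← Chain.snoc_eq_append]
        rfl
      exact ⟨1, _, _, f, g, p, e _, e _, e _⟩
    | head f g c =>
      intro p
      have e (x) : of (p.append (Chain.cons x c)) =
          rotInv^[c.size + 1] (of (Chain.cons x (c.append p))) := by
        have := rotInv_iterate_append (Chain.cons x c) p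
        rw [Chain.size, Chain.append] at this
        exact this.symm
      exact ⟨_, _, _, f, g, _, e _, e _, e _⟩
    | tail f h ih =>
      intro p
      have := ih (p.snoc f)
      simpa only [Chain.snoc_eq_append, Chain.append_assoc, Chain.append] using this
  cases h with
  | single f g => exact Or.inl ⟨f, g, rfl, rfl, rfl⟩
  | head f g c => exact Or.inr ⟨0, _, _, f, g, c, rfl, rfl, rfl⟩
  | tail f h =>
    right
    simpa only [Chain.append] using key h (Chain.single f)

end LinRel

/-- Linearity in each slot, expressed through `LinRel`. -/
def SlotLinear (φ : CycChain 𝒟 → ℂ) : Prop :=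
  ∀ ⦃a : ℂ⦄ ⦃X : 𝒟⦄ ⦃c₁ c₂ c₃ : Chain 𝒟 X X⦄, LinRel a c₁ c₂ c₃ →
    φ (of c₃) = a * φ (of c₁) + φ (of c₂)

namespace SlotLinear

variable {φ φ' : CycChain 𝒟 → ℂ}

theorem rotInv_iterate (hφ : SlotLinear φ) (k : ℕ) : SlotLinear fun t => φ (rotInv^[k] t) := by
  induction k with
  | zero => exact hφ
  | succ k ih =>
    intro a X c₁ c₂ c₃ h
    simp only [Function.iterate_succ_apply]
    cases h with
    | single f g => exact ih (LinRel.single f g)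
    | head f g c => exact ih (LinRel.snoc_right c f g)
    | tail f h => exact ih (h.snoc f)

theorem rot (hφ : SlotLinear φ) : SlotLinear fun t => φ (rot t) := by
  intro a X c₁ c₂ c₃ h
  simp only [rot_eq, len_of, h.size_eq.1, h.size_eq.2]
  exact hφ.rotInv_iterate _ h

theorem rot_iterate (hφ : SlotLinear φ) (k : ℕ) : SlotLinear fun t => φ (CFM.rot^[k] t) := by
  induction k with
  | zero => exact hφ
  | succ k ih =>
    simp only [Function.iterate_succ_apply]
    exact ih.rot

theorem face (hφ : SlotLinear φ) (i : ℕ) : SlotLinear fun t => φ (face i t) :=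
  fun _ _ _ _ _ h => hφ (h.composeAt i)

theorem const_mul (hφ : SlotLinear φ) (x : ℂ) : SlotLinear fun t => x * φ t := by
  intro a X c₁ c₂ c₃ h
  simp only [hφ h]
  ring

theorem add (hφ : SlotLinear φ) (hφ' : SlotLinear φ') : SlotLinear fun t => φ t + φ' t := by
  intro a X c₁ c₂ c₃ h
  simp only [hφ h, hφ' h]
  ring

theorem sub (hφ : SlotLinear φ) (hφ' : SlotLinear φ') : SlotLinear fun t => φ t - φ' t := by
  intro a X c₁ c₂ c₃ h
  simp only [hφ h, hφ' h]
  ring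

theorem sum {ι : Type*} (s : Finset ι) {F : ι → CycChain 𝒟 → ℂ} (hF : ∀ i ∈ s, SlotLinear (F i)) :
    SlotLinear fun t => ∑ i ∈ s, F i t := by
  intro a X c₁ c₂ c₃ h
  simp only [Finset.mul_sum, ← Finset.sum_add_distrib]
  exact Finset.sum_congr rfl fun i hi => hF i hi h

theorem hochschild (hφ : SlotLinear φ) (n : ℕ) : SlotLinear (hochschild n φ) :=
  (sum _ fun i _ => (hφ.face i).const_mul _).add ((hφ.face 0).rot.const_mul _)

theorem insertId (hφ : SlotLinear φ) (n : ℕ) : SlotLinear (insertId n φ) := by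
  have h₁ : SlotLinear fun t : CycChain 𝒟 => φ (of (Chain.cons (𝟙 t.1) t.2)) :=
    fun _ _ _ _ _ h => hφ (h.tail _)
  have h₂ : SlotLinear fun t : CycChain 𝒟 => φ (of (t.2.snoc (𝟙 t.1))) :=
    fun _ _ _ _ _ h => hφ (h.snoc _)
  exact h₁.sub (h₂.const_mul _)

theorem rotPrimitive (hφ : SlotLinear φ) (n : ℕ) : SlotLinear (rotPrimitive n φ) := by
  have h : SlotLinear fun t => ∑ k ∈ Finset.range (n + 1), ∑ i ∈ Finset.range k,
      (-1 : ℂ) ^ (n * i) * φ (CFM.rot^[i] t) :=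
    sum _ fun k _ => sum _ fun i _ => (hφ.rot_iterate i).const_mul _
  have := h.const_mul (-1)
  simp only [neg_one_mul] at this
  exact this

theorem isCochain (hφ : SlotLinear φ) : IsCochain (C := 𝒟) φ := by
  intro k
  have hk := hφ.rotInv_iterate k
  have zero_cons {X Y : 𝒟} (c : Chain 𝒟 X Y) :
      φ (rotInv^[k] (of (Chain.cons (0 : Y ⟶ X) c))) = 0 := by
    have := hk (LinRel.head (a := 1) 0 0 c)
    simpa using this
  have zero_single (X : 𝒟) : φ (rotInv^[k] (of (Chain.single (0 : X ⟶ X)))) = 0 := by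
    have := hk (LinRel.single (a := 1) (0 : X ⟶ X) 0)
    simpa using this
  refine ⟨fun f g c => ?_, fun a f c => ?_, fun f g => ?_, fun a f => ?_⟩
  · have := hk (LinRel.head (a := 1) f g c)
    simp only [one_smul, one_mul] at this
    exact this
  · have := hk (LinRel.head (a := a) f 0 c)
    simp only [add_zero, zero_cons] at this
    exact this
  · have := hk (LinRel.single (a := 1) f g)
    simp only [one_smul, one_mul] at this
    exact this
  · have := hk (LinRel.single (a := a) f 0)
    simp only [add_zero, zero_single] at this
    exact this

theorem of_isCochain (hφ : IsCochain (C := 𝒟) φ) : SlotLinear φ := by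
  intro a X c₁ c₂ c₃ h
  rcases h.exists_rotInv with ⟨f, g, rfl, rfl, rfl⟩ | ⟨k, Y, Z, f, g, c, h₁, h₂, h₃⟩
  · obtain ⟨-, -, hadd, hsmul⟩ := hφ 0
    exact (hadd (a • f) g).trans (congrArg (· + φ (of (Chain.single g))) (hsmul a f))
  · obtain ⟨hadd, hsmul, -, -⟩ := hφ k
    rw [h₁, h₂, h₃]
    exact (hadd (a • f) g c).trans
      (congrArg (· + φ (rotInv^[k] (of (Chain.cons g c)))) (hsmul a f c))

end SlotLinear

end Multilinear

section TotalSpace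

variable {S : DGSemicat.{u₁, v₁}} {W X Y Z : S.Obj}

/-- The total space of the complex of morphisms `X ⟶ Y` in a DG-semicategory. -/
abbrev Tot (S : DGSemicat.{u₁, v₁}) (X Y : S.Obj) : Type v₁ := DirectSum ℕ (S.Hom X Y)

namespace Tot

/-- A homogeneous morphism as an element of the total space. -/
def of {k : ℕ} (f : S.Hom X Y k) : Tot S X Y := DirectSum.lof ℂ ℕ (S.Hom X Y) k f

theorem of_add {k : ℕ} (f g : S.Hom X Y k) : of (f + g) = of f + of g := map_add _ _ _

theorem of_smul {k : ℕ} (a : ℂ) (f : S.Hom X Y k) : of (a • f) = a • of f := map_smul _ _ _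

theorem of_zero {k : ℕ} : of (0 : S.Hom X Y k) = 0 := map_zero _

theorem of_degCast {a b : ℕ} (h : a = b) (f : S.Hom X Y a) : of (degCast h f) = of f := by
  subst h
  rfl

@[elab_as_elim]
theorem induction {p : Tot S X Y → Prop} (x : Tot S X Y) (zero : p 0)
    (of : ∀ {k : ℕ} (f : S.Hom X Y k), p (of f)) (add : ∀ x y, p x → p y → p (x + y)) : p x :=
  DirectSum.induction_on x zero (fun _ f => of f) add

/-- Composition, extended to total spaces. -/
def mul : Tot S Y Z →ₗ[ℂ] Tot S X Y →ₗ[ℂ] Tot S X Z :=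
  DirectSum.toModule ℂ ℕ _ fun i => LinearMap.flip <| DirectSum.toModule ℂ ℕ _ fun j =>
    (LinearMap.mk₂ ℂ (fun (f : S.Hom X Y j) (g : S.Hom Y Z i) => S.comp (rfl : i + j = i + j) g f)
      (fun f f' g => S.comp_add_right _ g f f') (fun a f g => S.comp_smul_right _ a g f)
      (fun f g g' => S.comp_add_left _ g g' f) (fun a f g => S.comp_smul_left _ a g f)).compr₂
    (DirectSum.lof ℂ ℕ (S.Hom X Z) (i + j))

/-- The differential, extended to total spaces. -/
def d : Tot S X Y →ₗ[ℂ] Tot S X Y :=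
  DirectSum.toModule ℂ ℕ _ fun i => (DirectSum.lof ℂ ℕ (S.Hom X Y) (i + 1)).comp
    ({ toFun := S.d, map_add' := S.d_add, map_smul' := S.d_smul } :
      S.Hom X Y i →ₗ[ℂ] S.Hom X Y (i + 1))

theorem mul_of {i j k : ℕ} (h : i + j = k) (g : S.Hom Y Z i) (f : S.Hom X Y j) :
    mul (of g) (of f) = of (S.comp h g f) := by
  subst h
  simp only [mul, of, DirectSum.toModule_lof, LinearMap.flip_apply, LinearMap.compr₂_apply,
    LinearMap.mk₂_apply]

theorem d_of {k : ℕ} (f : S.Hom X Y k) : d (of f) = of (S.d f) := by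
  simp only [d, of, DirectSum.toModule_lof, LinearMap.comp_apply]
  rfl

theorem mul_assoc (x : Tot S Y Z) (y : Tot S X Y) (z : Tot S W X) :
    mul (mul x y) z = mul x (mul y z) := by
  induction x using Tot.induction with
  | zero => simp
  | add x x' hx hx' => simp only [map_add, LinearMap.add_apply, hx, hx']
  | of g =>
    induction y using Tot.induction with
    | zero => simp
    | add y y' hy hy' => simp only [map_add, LinearMap.add_apply, hy, hy']
    | of f =>
      induction z using Tot.induction with
      | zero => simp
      | add z z' hz hz' => simp only [map_add, hz, hz']
      | of e =>
        rw [mul_of rfl, mul_of rfl, mul_of rfl, mul_of (add_assoc _ _ _).symm]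
        exact congrArg of (S.comp_assoc _ _ _ _ g f e)

theorem d_of_mul {i : ℕ} (g : S.Hom Y Z i) (y : Tot S X Y) :
    d (mul (of g) y) = mul (of (S.d g)) y + (-1 : ℂ) ^ i • mul (of g) (d y) := by
  induction y using Tot.induction with
  | zero => simp
  | add y y' hy hy' =>
    simp only [map_add, hy, hy']
    module
  | of f =>
    rw [mul_of rfl, d_of, d_of, mul_of (Nat.add_right_comm _ 1 _), mul_of (Nat.add_assoc _ _ 1).symm,
      S.leibniz rfl (Nat.add_right_comm _ 1 _) (Nat.add_assoc _ _ 1).symm, of_add, of_smul]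

end Tot

end TotalSpace

section Cycle

variable {𝒟 : Type u} [Category.{v} 𝒟] [Preadditive 𝒟] [CategoryTheory.Linear ℂ 𝒟] {m : ℕ}
  (Z : CycleOver.{u, v, u₁, v₁} 𝒟 m)

namespace CycleOver

/-- The trace, extended by zero to total spaces. -/
def trace (X : Z.S.Obj) : Tot Z.S X X →ₗ[ℂ] ℂ :=
  (Z.tr X).comp (DirectSum.component ℂ ℕ (Z.S.Hom X X) m)

theorem trace_of {X : Z.S.Obj} {k : ℕ} (f : Z.S.Hom X X k) :
    Z.trace X (Tot.of f) = if h : k = m then Z.tr X (degCast h f) else 0 := by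
  rw [trace, LinearMap.comp_apply, Tot.of, DirectSum.component.of]
  by_cases h : k = m
  · subst h
    simp [degCast]
  · simp [h]

theorem trace_d {X : Z.S.Obj} (x : Tot Z.S X X) : Z.trace X (Tot.d x) = 0 := by
  induction x using Tot.induction with
  | zero => simp
  | add x y hx hy => simp [hx, hy]
  | of f =>
    rw [Tot.d_of, trace_of]
    split_ifs with h
    · subst h
      exact Z.tr_closed rfl f
    · rfl

theorem trace_of_mul {X Y : Z.S.Obj} {i : ℕ} (g : Z.S.Hom Y X i) (x : Tot Z.S X Y) :
    Z.trace X (Tot.mul (Tot.of g) x) = (-1 : ℂ) ^ (i * (m + i)) * Z.trace Y (Tot.mul x (Tot.of g)) := by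
  induction x using Tot.induction with
  | zero => simp
  | add x y hx hy => simp only [map_add, LinearMap.add_apply, hx, hy, mul_add]
  | @of j f =>
    rw [Tot.mul_of rfl, Tot.mul_of (add_comm j i), trace_of, trace_of]
    split_ifs with h
    · subst h
      rw [show i * (i + j + i) = i * j + 2 * (i * i) by ring, pow_add, pow_mul _ 2]
      simpa [degCast] using Z.tr_graded rfl (add_comm j i) g f
    · simp

/-- `ρ(f)` in the total space. -/
def R {X Y : 𝒟} (f : X ⟶ Y) : Tot Z.S (Z.ρObj X) (Z.ρObj Y) := Tot.of (Z.ρMap f)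

/-- `∂̂ρ(f)` in the total space. -/
def D {X Y : 𝒟} (f : X ⟶ Y) : Tot Z.S (Z.ρObj X) (Z.ρObj Y) := Tot.of (Z.S.d (Z.ρMap f))

theorem R_comp {V X Y : 𝒟} (f : V ⟶ X) (g : X ⟶ Y) : Z.R (f ≫ g) = Tot.mul (Z.R g) (Z.R f) := by
  rw [R, Z.ρMap_comp, R, R, Tot.mul_of]

theorem D_comp {V X Y : 𝒟} (f : V ⟶ X) (g : X ⟶ Y) :
    Z.D (f ≫ g) = Tot.mul (Z.D g) (Z.R f) + Tot.mul (Z.R g) (Z.D f) := by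
  rw [D, ← Tot.d_of, Z.ρMap_comp, ← Tot.mul_of, Tot.d_of_mul, Tot.d_of, pow_zero, one_smul]
  rfl

theorem R_linear {X Y : 𝒟} (a : ℂ) (f g : X ⟶ Y) : Z.R (a • f + g) = a • Z.R f + Z.R g := by
  rw [R, Z.ρMap_add, Z.ρMap_smul, Tot.of_add, Tot.of_smul]
  rfl

theorem D_linear {X Y : 𝒟} (a : ℂ) (f g : X ⟶ Y) : Z.D (a • f + g) = a • Z.D f + Z.D g := by
  rw [D, Z.ρMap_add, Z.ρMap_smul, Z.S.d_add, Z.S.d_smul, Tot.of_add, Tot.of_smul]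
  rfl

theorem d_R_mul {X Y : 𝒟} (f : X ⟶ Y) {V : Z.S.Obj} (x : Tot Z.S V (Z.ρObj X)) :
    Tot.d (Tot.mul (Z.R f) x) = Tot.mul (Z.D f) x + Tot.mul (Z.R f) (Tot.d x) := by
  rw [R, Tot.d_of_mul, pow_zero, one_smul]
  rfl

theorem d_R {X Y : 𝒟} (f : X ⟶ Y) : Tot.d (Z.R f) = Z.D f := Tot.d_of _

theorem d_D {X Y : 𝒟} (f : X ⟶ Y) : Tot.d (Z.D f) = 0 := by
  rw [D, Tot.d_of, Z.S.d_sq, Tot.of_zero]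

theorem d_D_mul {X Y : 𝒟} (f : X ⟶ Y) {V : Z.S.Obj} (x : Tot Z.S V (Z.ρObj X)) :
    Tot.d (Tot.mul (Z.D f) x) = -Tot.mul (Z.D f) (Tot.d x) := by
  rw [D, Tot.d_of_mul, Z.S.d_sq, Tot.of_zero]
  simp

theorem trace_R_mul {X Y : 𝒟} (f : Y ⟶ X) (x : Tot Z.S (Z.ρObj X) (Z.ρObj Y)) :
    Z.trace _ (Tot.mul (Z.R f) x) = Z.trace _ (Tot.mul x (Z.R f)) := by
  rw [R, trace_of_mul]
  simp

theorem trace_D_mul {X Y : 𝒟} (f : Y ⟶ X) (x : Tot Z.S (Z.ρObj X) (Z.ρObj Y)) :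
    Z.trace _ (Tot.mul (Z.D f) x) = (-1) ^ (m + 1) * Z.trace _ (Tot.mul x (Z.D f)) := by
  rw [D, trace_of_mul]
  simp

/-- `∂̂ρ(f⁰) ∘ ⋯ ∘ ∂̂ρ(fⁿ)` in the total space. -/
def totD {X Y : 𝒟} (c : Chain 𝒟 X Y) : Tot Z.S (Z.ρObj X) (Z.ρObj Y) := Tot.of (prodD Z X Y c)

/-- `∂̂ρ(f⁰) ∘ ⋯ ∘ ρ(fʲ) ∘ ⋯ ∘ ∂̂ρ(fⁿ)` in the total space. -/
def totExcept {X Y : 𝒟} (c : Chain 𝒟 X Y) (j : ℕ) : Tot Z.S (Z.ρObj X) (Z.ρObj Y) :=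
  Tot.of (prodDExcept Z X Y c j)

/-- `ρ(f⁰) ∘ ∂̂ρ(f¹) ∘ ⋯ ∘ ρ(fʲ) ∘ ⋯ ∘ ∂̂ρ(fⁿ)` in the total space. -/
def totPsi {X Y : 𝒟} (c : Chain 𝒟 X Y) (j : ℕ) : Tot Z.S (Z.ρObj X) (Z.ρObj Y) :=
  Tot.of (psiEl Z X Y c j)

theorem totD_single {X Y : 𝒟} (f : X ⟶ Y) : Z.totD (Chain.single f) = Z.D f := by
  rw [totD, prodD, Tot.of_degCast, D]

theorem totD_cons {V X Y : 𝒟} (f : X ⟶ Y) (c : Chain 𝒟 V X) :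
    Z.totD (Chain.cons f c) = Tot.mul (Z.D f) (Z.totD c) := by
  rw [totD, prodD, ← Tot.mul_of, D, totD]

theorem totExcept_single {X Y : 𝒟} (f : X ⟶ Y) (j : ℕ) :
    Z.totExcept (Chain.single f) j = Z.R f := by
  rw [totExcept, prodDExcept, Tot.of_degCast, R]

theorem totExcept_cons_zero {V X Y : 𝒟} (f : X ⟶ Y) (c : Chain 𝒟 V X) :
    Z.totExcept (Chain.cons f c) 0 = Tot.mul (Z.R f) (Z.totD c) := by
  rw [totExcept, prodDExcept, ← Tot.mul_of, R, totD]

theorem totExcept_cons_succ {V X Y : 𝒟} (f : X ⟶ Y) (c : Chain 𝒟 V X) (j : ℕ) :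
    Z.totExcept (Chain.cons f c) (j + 1) = Tot.mul (Z.D f) (Z.totExcept c j) := by
  rw [totExcept, prodDExcept, ← Tot.mul_of, D, totExcept]

theorem totPsi_single {X Y : 𝒟} (f : X ⟶ Y) (j : ℕ) : Z.totPsi (Chain.single f) j = Z.R f := by
  rw [totPsi, psiEl, Tot.of_degCast, R]

theorem totPsi_cons {V X Y : 𝒟} (f : X ⟶ Y) (c : Chain 𝒟 V X) (j : ℕ) :
    Z.totPsi (Chain.cons f c) (j + 1) = Tot.mul (Z.R f) (Z.totExcept c j) := by
  rw [totPsi, psiEl, ← Tot.mul_of, R, totExcept]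
  rfl

theorem of_charEl {X Y : 𝒟} (c : Chain 𝒟 X Y) : Tot.of (charEl Z X Y c) = Z.totExcept c 0 := by
  cases c with
  | single f => rw [charEl, Tot.of_degCast, totExcept_single, R]
  | cons f c => rw [charEl, ← Tot.mul_of, totExcept_cons_zero, R, totD]

theorem charCochain_of {X : 𝒟} (c : Chain 𝒟 X X) :
    charCochain Z (CycChain.of c) = Z.trace _ (Z.totExcept c 0) := by
  rw [← of_charEl, trace_of]
  by_cases h : c.size - 1 = m
  · subst h
    rw [charCochain, dif_pos (show (CycChain.of c).2.size - 1 = c.size - 1 from rfl), dif_pos rfl]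
    rfl
  · rw [charCochain, dif_neg (show ¬(CycChain.of c).2.size - 1 = m from h), dif_neg h]

theorem trPsi_eq {X : 𝒟} (c : Chain 𝒟 X X) (j : ℕ) : trPsi Z c j = Z.trace _ (Z.totPsi c j) := by
  rw [totPsi, trace_of]
  by_cases h : c.size - 2 = m
  · subst h
    rw [trPsi, dif_pos rfl, dif_pos rfl]
    rfl
  · rw [trPsi, dif_neg h, dif_neg h]

theorem totD_snoc {V X Y : 𝒟} (c : Chain 𝒟 X Y) (l : V ⟶ X) :
    Z.totD (c.snoc l) = Tot.mul (Z.totD c) (Z.D l) := by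
  induction c with
  | single f => rw [Chain.snoc, totD_cons, totD_single, totD_single]
  | cons f c ih => rw [Chain.snoc, totD_cons, totD_cons, ih, Tot.mul_assoc]

theorem totExcept_snoc {V X Y : 𝒟} (c : Chain 𝒟 X Y) (l : V ⟶ X) (j : ℕ) (hj : j < c.size) :
    Z.totExcept (c.snoc l) j = Tot.mul (Z.totExcept c j) (Z.D l) := by
  induction c generalizing j with
  | single f =>
    rw [Chain.size] at hj
    obtain rfl : j = 0 := by omega
    rw [Chain.snoc, totExcept_cons_zero, totExcept_single, totD_single]
  | cons f c ih =>
    rw [Chain.size] at hj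
    cases j with
    | zero => rw [Chain.snoc, totExcept_cons_zero, totExcept_cons_zero, totD_snoc, Tot.mul_assoc]
    | succ j =>
      rw [Chain.snoc, totExcept_cons_succ, totExcept_cons_succ, ih _ (by omega), Tot.mul_assoc]

theorem totExcept_snoc_size {V X Y : 𝒟} (c : Chain 𝒟 X Y) (l : V ⟶ X) {j : ℕ} (hj : c.size = j) :
    Z.totExcept (c.snoc l) j = Tot.mul (Z.totD c) (Z.R l) := by
  induction c generalizing j with
  | single f =>
    rw [Chain.size] at hj
    rw [← hj, Chain.snoc, ← zero_add 1, totExcept_cons_succ, totExcept_single, totD_single]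
  | cons f c ih =>
    rw [Chain.size] at hj
    rw [← hj, Chain.snoc, totExcept_cons_succ, ih rfl, totD_cons, Tot.mul_assoc]

theorem d_totD {X Y : 𝒟} (c : Chain 𝒟 X Y) : Tot.d (Z.totD c) = 0 := by
  induction c with
  | single f => rw [totD_single, d_D]
  | cons f c ih => rw [totD_cons, d_D_mul, ih, map_zero, neg_zero]

theorem d_totExcept {X Y : 𝒟} (c : Chain 𝒟 X Y) (j : ℕ) (hj : j < c.size) :
    Tot.d (Z.totExcept c j) = (-1 : ℂ) ^ j • Z.totD c := by
  induction c generalizing j with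
  | single f =>
    rw [Chain.size] at hj
    obtain rfl : j = 0 := by omega
    rw [totExcept_single, d_R, totD_single, pow_zero, one_smul]
  | cons f c ih =>
    rw [Chain.size] at hj
    cases j with
    | zero =>
      rw [totExcept_cons_zero, d_R_mul, d_totD, map_zero, add_zero, totD_cons, pow_zero, one_smul]
    | succ j =>
      rw [totExcept_cons_succ, d_D_mul, ih _ (by omega), totD_cons, map_smul, pow_succ]
      module

theorem totD_composeAt_zero {V X Y : 𝒟} (f : X ⟶ Y) (c : Chain 𝒟 V X) :
    Z.totD ((Chain.cons f c).composeAt 0) =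
      Tot.mul (Z.D f) (Z.totExcept c 0) + Tot.mul (Z.R f) (Z.totD c) := by
  cases c with
  | single g => rw [Chain.composeAt, totD_single, D_comp, totExcept_single, totD_single]
  | cons g c =>
    rw [Chain.composeAt, totD_cons, D_comp, totExcept_cons_zero, totD_cons, map_add,
      LinearMap.add_apply, Tot.mul_assoc, Tot.mul_assoc]

theorem totExcept_composeAt_zero {V X Y : 𝒟} (f : X ⟶ Y) (c : Chain 𝒟 V X) :
    Z.totExcept ((Chain.cons f c).composeAt 0) 0 = Tot.mul (Z.R f) (Z.totExcept c 0) := by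
  cases c with
  | single g => rw [Chain.composeAt, totExcept_single, R_comp, totExcept_single]
  | cons g c =>
    rw [Chain.composeAt, totExcept_cons_zero, R_comp, totExcept_cons_zero, Tot.mul_assoc]

theorem totExcept_composeAt_zero_succ {V W X Y : 𝒟} (f : X ⟶ Y) (g : W ⟶ X) (c : Chain 𝒟 V W)
    (j : ℕ) :
    Z.totExcept ((Chain.cons f (Chain.cons g c)).composeAt 0) (j + 1) =
      Tot.mul (Z.D f) (Z.totPsi (Chain.cons g c) (j + 1)) +
        Tot.mul (Z.R f) (Z.totExcept (Chain.cons g c) (j + 1)) := by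
  rw [Chain.composeAt, totExcept_cons_succ, D_comp, totPsi_cons, totExcept_cons_succ, map_add,
    LinearMap.add_apply, Tot.mul_assoc, Tot.mul_assoc]

theorem totPsi_composeAt_zero {V W X Y : 𝒟} (f : X ⟶ Y) (g : W ⟶ X) (c : Chain 𝒟 V W) (j : ℕ) :
    Z.totPsi ((Chain.cons f (Chain.cons g c)).composeAt 0) (j + 1) =
      Tot.mul (Z.R f) (Z.totPsi (Chain.cons g c) (j + 1)) := by
  rw [Chain.composeAt, totPsi_cons, R_comp, totPsi_cons, Tot.mul_assoc]

theorem sum_totD_composeAt {X Y : 𝒟} (c : Chain 𝒟 X Y) (k : ℕ) (hk : c.size = k + 1) :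
    ∑ i ∈ Finset.range k, (-1 : ℂ) ^ i • Z.totD (c.composeAt i) =
      Z.totExcept c 0 - (-1 : ℂ) ^ k • Z.totExcept c k := by
  induction c generalizing k with
  | single f =>
    rw [Chain.size] at hk
    obtain rfl : k = 0 := by omega
    simp
  | cons f c ih =>
    rw [Chain.size] at hk
    obtain ⟨k, rfl⟩ : ∃ k', k = k' + 1 := ⟨c.size - 1, by have := c.one_le_size; omega⟩
    have ih' := congrArg (Tot.mul (Z.D f)) (ih k (by omega))
    simp only [map_sum, map_smul, map_sub] at ih'
    rw [Finset.sum_range_succ', totD_composeAt_zero, totExcept_cons_zero, totExcept_cons_succ]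
    simp only [Chain.composeAt, totD_cons, pow_succ, mul_neg, mul_one, neg_smul,
      Finset.sum_neg_distrib, ih', pow_zero, one_smul]
    module

theorem sum_totExcept_composeAt_zero {V X Y : 𝒟} (c : Chain 𝒟 X Y) (l : V ⟶ X) :
    Z.totPsi (c.snoc l) 1 +
        ∑ i ∈ Finset.range c.size, (-1 : ℂ) ^ (i + 1) • Z.totExcept ((c.snoc l).composeAt i) 0 +
        (-1 : ℂ) ^ (c.size + 1) • Tot.mul (Z.totExcept c 0) (Z.R l) =
      Z.totExcept ((c.snoc l).composeAt 0) 0 := by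
  cases c with
  | single f =>
    simp only [Chain.snoc, Chain.size, totPsi_cons _ _ _ 0, Finset.sum_range_one,
      totExcept_composeAt_zero, totExcept_single]
    module
  | cons f c =>
    have hA := congrArg (Tot.mul (Z.R f)) (Z.sum_totD_composeAt (c.snoc l) c.size (c.size_snoc l))
    simp only [map_sum, map_smul, map_sub] at hA
    rw [Chain.snoc, totPsi_cons _ _ _ 0, Chain.size, Finset.sum_range_succ',
      totExcept_composeAt_zero]
    simp only [Chain.composeAt, totExcept_cons_zero, pow_succ, mul_neg, mul_one, neg_neg, hA,
      Z.totExcept_snoc_size c l rfl, pow_zero, Tot.mul_assoc]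
    module

theorem sum_totExcept_composeAt {V X Y : 𝒟} (c : Chain 𝒟 X Y) (l : V ⟶ X) (j : ℕ)
    (hj : j < c.size) :
    Z.totPsi (c.snoc l) (j + 1) +
        ∑ i ∈ Finset.range c.size, (-1 : ℂ) ^ (i + 1) • Z.totExcept ((c.snoc l).composeAt i) j +
        (-1 : ℂ) ^ (c.size + 1) • Tot.mul (Z.totExcept c j) (Z.R l) =
      (-1 : ℂ) ^ j • Z.totExcept ((c.snoc l).composeAt j) j := by
  induction c generalizing j with
  | single f =>
    rw [Chain.size] at hj
    obtain rfl : j = 0 := by omega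
    rw [sum_totExcept_composeAt_zero, pow_zero, one_smul]
  | cons f c ih =>
    rw [Chain.size] at hj
    cases j with
    | zero => rw [sum_totExcept_composeAt_zero, pow_zero, one_smul]
    | succ j =>
      have ih' := congrArg (Tot.mul (Z.D f)) (ih j (by omega))
      obtain ⟨W, g, c', hc⟩ : ∃ (W : 𝒟) (g : W ⟶ _) (c' : Chain 𝒟 _ W),
          c.snoc l = Chain.cons g c' := by
        cases c with
        | single g => exact ⟨_, g, _, by rw [Chain.snoc]⟩
        | cons g c => exact ⟨_, g, _, by rw [Chain.snoc]⟩
      simp only [map_sum, map_smul, map_add] at ih'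
      rw [Chain.snoc, totPsi_cons, Chain.size, Finset.sum_range_succ']
      have h0 := Z.totExcept_composeAt_zero_succ f g c' j
      rw [← hc] at h0
      simp only [h0, Chain.composeAt, totExcept_cons_succ, pow_succ, mul_neg, mul_one, neg_neg,
        pow_zero, Tot.mul_assoc] at ih' ⊢
      simp only [neg_smul, Finset.sum_neg_distrib, one_smul] at ih' ⊢
      rw [← ih']
      module

variable {a : ℂ}

theorem totD_linRel {X Y : 𝒟} {c₁ c₂ c₃ : Chain 𝒟 X Y} (h : LinRel a c₁ c₂ c₃) :
    Z.totD c₃ = a • Z.totD c₁ + Z.totD c₂ := by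
  induction h with
  | single f g => simp only [totD_single, D_linear]
  | head f g c => simp only [totD_cons, D_linear, map_add, map_smul, LinearMap.add_apply,
      LinearMap.smul_apply]
  | tail f h ih => simp only [totD_cons, ih, map_add, map_smul]

theorem totExcept_linRel {X Y : 𝒟} {c₁ c₂ c₃ : Chain 𝒟 X Y} (h : LinRel a c₁ c₂ c₃) (j : ℕ) :
    Z.totExcept c₃ j = a • Z.totExcept c₁ j + Z.totExcept c₂ j := by
  induction h generalizing j with
  | single f g => simp only [totExcept_single, R_linear]
  | head f g c =>
    cases j <;>
    simp only [totExcept_cons_zero, totExcept_cons_succ, R_linear, D_linear, map_add, map_smul,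
      LinearMap.add_apply, LinearMap.smul_apply]
  | tail f h ih =>
    cases j with
    | zero => simp only [totExcept_cons_zero, Z.totD_linRel h, map_add, map_smul]
    | succ j => simp only [totExcept_cons_succ, ih, map_add, map_smul]

theorem totPsi_linRel {X Y : 𝒟} {c₁ c₂ c₃ : Chain 𝒟 X Y} (h : LinRel a c₁ c₂ c₃) (j : ℕ) :
    Z.totPsi c₃ (j + 1) = a • Z.totPsi c₁ (j + 1) + Z.totPsi c₂ (j + 1) := by
  cases h with
  | single f g => simp only [totPsi_single, R_linear]
  | head f g c =>
    simp only [totPsi_cons, R_linear, map_add, map_smul, LinearMap.add_apply, LinearMap.smul_apply]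
  | tail f h => simp only [totPsi_cons, Z.totExcept_linRel h, map_add, map_smul]

/-- The Hochschild primitive of `S φ`, as a function on the cyclic nerve. -/
def primitive (t : CycChain 𝒟) : ℂ :=
  ∑ j ∈ Finset.range (m + 1), (-1 : ℂ) ^ j * Z.trace _ (Z.totPsi t.2 (j + 1))

/-- The image of the character under the periodicity operator, as a function on the cyclic
nerve. -/
def periodicity (t : CycChain 𝒟) : ℂ :=
  ∑ j ∈ Finset.range (m + 1), Z.trace _ (Z.totPsi (t.2.composeAt (j + 1)) (j + 1))

/-- The character, as a function on the cyclic nerve. -/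
def character (t : CycChain 𝒟) : ℂ := Z.trace _ (Z.totExcept t.2 0)

theorem SCochain_eq (t : CycChain 𝒟) : SCochain Z t = Z.periodicity t := by
  have h (f : ℕ → ℂ) : ∑ j ∈ Finset.Icc 1 (m + 1), f j = ∑ j ∈ Finset.range (m + 1), f (j + 1) := by
    rw [← Finset.Ico_add_one_right_eq_Icc, Finset.sum_Ico_eq_sum_range]
    simp only [add_comm 1, Nat.add_sub_cancel]
  rw [SCochain, h, periodicity]
  simp only [trPsi_eq]

open CycChain

theorem primitive_of {X : 𝒟} (c : Chain 𝒟 X X) : Z.primitive (of c) =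
    ∑ j ∈ Finset.range (m + 1), (-1 : ℂ) ^ j * Z.trace _ (Z.totPsi c (j + 1)) := rfl

theorem periodicity_of {X : 𝒟} (c : Chain 𝒟 X X) : Z.periodicity (of c) =
    ∑ j ∈ Finset.range (m + 1), Z.trace _ (Z.totPsi (c.composeAt (j + 1)) (j + 1)) := rfl

theorem character_of {X : 𝒟} (c : Chain 𝒟 X X) :
    Z.character (of c) = Z.trace _ (Z.totExcept c 0) := rfl

theorem slotLinear_primitive : SlotLinear Z.primitive := by
  refine SlotLinear.sum _ fun j _ => SlotLinear.const_mul ?_ _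
  intro a X c₁ c₂ c₃ h
  have := congrArg (Z.trace _) (Z.totPsi_linRel h j)
  simp only [map_add, map_smul, smul_eq_mul] at this
  exact this

/-- `S φ = b θ`, where `θ` is the primitive. -/
theorem hochschild_primitive (t : CycChain 𝒟) (ht : t.len = m + 3) :
    hochschild (m + 1) Z.primitive t = Z.periodicity t := by
  obtain ⟨X, c, rfl⟩ := t.exists_eq_of
  rw [len_of] at ht
  cases c with
  | single f => rw [Chain.size] at ht; omega
  | cons f₀ c =>
    rw [Chain.size] at ht
    obtain ⟨V, c, l, rfl⟩ := c.exists_snoc (by omega)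
    rw [Chain.size_snoc] at ht
    obtain ⟨V', g, c', hc⟩ : ∃ (V' : 𝒟) (g : V' ⟶ _) (c' : Chain 𝒟 _ V'),
        c.snoc l = Chain.cons g c' := by
      cases c with
      | single g => exact ⟨_, g, _, by rw [Chain.snoc]⟩
      | cons g c => exact ⟨_, g, _, by rw [Chain.snoc]⟩
    have h0 (j : ℕ) := Z.totPsi_composeAt_zero f₀ g c' j
    rw [← hc] at h0
    rw [hochschild, rot_cons_snoc, Finset.sum_range_succ']
    simp only [face_of, primitive_of, periodicity_of, h0]
    have hB (j : ℕ) (hj : j ∈ Finset.range (m + 1)) := congrArg (fun x => Z.trace _ (Tot.mul (Z.R f₀) x))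
      (Z.sum_totExcept_composeAt c l j (by simp at hj; omega))
    have hl (j : ℕ) : Z.trace _ (Tot.mul (Z.R l) (Tot.mul (Z.R f₀) (Z.totExcept c j))) =
        Z.trace _ (Tot.mul (Z.R f₀) (Tot.mul (Z.totExcept c j) (Z.R l))) := by
      rw [trace_R_mul, Tot.mul_assoc]
    simp only [Chain.composeAt, totPsi_cons, R_comp, Tot.mul_assoc, hl]
    simp only [show c.size = m + 1 by omega, map_add, map_sum, map_smul, smul_eq_mul] at hB
    simp only [Finset.mul_sum]
    rw [Finset.sum_comm, ← Finset.sum_add_distrib, ← Finset.sum_add_distrib]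
    refine Finset.sum_congr rfl fun j hj => ?_
    have hs : ((-1 : ℂ) ^ j) * (-1) ^ j = 1 := neg_one_pow_mul_self j
    simp only [mul_left_comm _ ((-1 : ℂ) ^ j), ← Finset.mul_sum]
    linear_combination (-1 : ℂ) ^ j * hB j hj +
      Z.trace _ (Tot.mul (Z.R f₀) (Z.totExcept ((c.snoc l).composeAt j) j)) * hs

theorem truncHochschild_character (t : CycChain 𝒟) (ht : t.len = m + 2) :
    truncHochschild m Z.character t = (-1) ^ m * Z.character (face 0 (rot t)) := by
  obtain ⟨X, c, rfl⟩ := t.exists_eq_of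
  rw [len_of] at ht
  cases c with
  | single f => rw [Chain.size] at ht; omega
  | cons f₀ c =>
    rw [Chain.size] at ht
    have hA := congrArg (fun x => Z.trace _ (Tot.mul (Z.R f₀) x))
      (Z.sum_totD_composeAt c m (by omega))
    simp only [map_sub, map_sum, map_smul, smul_eq_mul] at hA
    have hX : Z.character (face 0 (rot (of (Chain.cons f₀ c)))) =
        Z.trace _ (Tot.mul (Z.R f₀) (Z.totExcept c m)) := by
      cases c with
      | single l =>
        rw [rot_cons_single, face_of, character_of, totExcept_composeAt_zero, trace_R_mul]
        simp only [totExcept_single]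
      | cons g c =>
        obtain ⟨V, c', l, hc⟩ := (Chain.cons g c).exists_snoc
          (by rw [Chain.size]; have := c.one_le_size; omega)
        rw [hc] at ht ⊢
        rw [Chain.size_snoc] at ht
        rw [rot_cons_snoc, face_of, character_of, totExcept_composeAt_zero, trace_R_mul,
          totExcept_cons_zero, Z.totExcept_snoc_size c' l (by omega), Tot.mul_assoc]
    rw [truncHochschild, Finset.sum_range_succ', hX, face_of, character_of,
      totExcept_composeAt_zero]
    simp only [face_of, Chain.composeAt, character_of, totExcept_cons_zero, pow_succ, mul_neg,
      mul_one, neg_mul, Finset.sum_neg_distrib, hA]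
    ring

theorem primitive_sub_signedRot (t : CycChain 𝒟) (ht : t.len = m + 2) :
    Z.primitive t - signedRot (m + 1) Z.primitive t =
      (m + 2) * truncHochschild m Z.character t := by
  rw [truncHochschild_character Z t ht]
  obtain ⟨X, c, rfl⟩ := t.exists_eq_of
  rw [len_of] at ht
  cases c with
  | single f => rw [Chain.size] at ht; omega
  | cons f₀ c =>
    rw [Chain.size] at ht
    cases c with
    | single l =>
      rw [Chain.size] at ht
      obtain rfl : m = 0 := by omega
      rw [signedRot, rot_cons_single, face_of, primitive_of, primitive_of, character_of,
        totExcept_composeAt_zero]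
      simp [totPsi_cons _ _ _ 0, totExcept_single, Z.trace_R_mul l]
      ring
    | cons g c =>
      obtain ⟨V, c', l, hc⟩ := (Chain.cons g c).exists_snoc
        (by rw [Chain.size]; have := c.one_le_size; omega)
      rw [hc] at ht ⊢
      rw [Chain.size_snoc] at ht
      have hcl (j : ℕ) (hj : j ∈ Finset.range m) :
          (-1 : ℂ) ^ j * ((-1) ^ (m + 1) *
            Z.trace _ (Tot.mul (Z.R f₀) (Tot.mul (Z.totExcept c' j) (Z.D l)))) +
          (-1) ^ j * Z.trace _ (Tot.mul (Z.R l) (Tot.mul (Z.D f₀) (Z.totExcept c' j))) =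
          -Z.trace _ (Tot.mul (Z.R l) (Tot.mul (Z.R f₀) (Z.totD c'))) := by
        have h := Z.trace_d (Tot.mul (Z.R l) (Tot.mul (Z.R f₀) (Z.totExcept c' j)))
        rw [d_R_mul, d_R_mul, d_totExcept _ _ _ (by simp at hj; omega), map_add, trace_D_mul,
          Tot.mul_assoc] at h
        simp only [map_add, map_smul, smul_eq_mul] at h
        linear_combination (-1 : ℂ) ^ j * h -
          Z.trace _ (Tot.mul (Z.R l) (Tot.mul (Z.R f₀) (Z.totD c'))) * neg_one_pow_mul_self j
      have hsum := Finset.sum_congr rfl hcl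
      rw [Finset.sum_add_distrib, Finset.sum_const, Finset.card_range, nsmul_eq_mul] at hsum
      simp only [mul_left_comm _ ((-1 : ℂ) ^ (m + 1)), ← Finset.mul_sum] at hsum
      have hleft : ∑ j ∈ Finset.range m, (-1 : ℂ) ^ j *
          Z.trace _ (Tot.mul (Z.R f₀) (Z.totExcept (c'.snoc l) j)) =
          ∑ j ∈ Finset.range m, (-1 : ℂ) ^ j *
          Z.trace _ (Tot.mul (Z.R f₀) (Tot.mul (Z.totExcept c' j) (Z.D l))) :=
        Finset.sum_congr rfl fun j hj => by
          rw [totExcept_snoc _ _ _ _ (by simp at hj; omega)]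
      have hX : Z.trace _ (Tot.mul (Z.R f₀) (Tot.mul (Z.totD c') (Z.R l))) =
          Z.trace _ (Tot.mul (Z.R l) (Tot.mul (Z.R f₀) (Z.totD c'))) := by
        rw [Z.trace_R_mul l, Tot.mul_assoc]
      rw [signedRot, rot_cons_snoc, face_of, primitive_of, primitive_of, character_of,
        totExcept_composeAt_zero]
      simp only [totPsi_cons]
      rw [Finset.sum_range_succ, Finset.sum_range_succ', hleft,
        Z.totExcept_snoc_size c' l (by omega), hX]
      simp only [totExcept_cons_zero, totExcept_cons_succ]
      have hp (F : ℕ → ℂ) : ∑ j ∈ Finset.range m, (-1 : ℂ) ^ (j + 1) * F j =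
          -∑ j ∈ Finset.range m, (-1 : ℂ) ^ j * F j := by
        rw [← Finset.sum_neg_distrib]
        exact Finset.sum_congr rfl fun j _ => by ring
      rw [hp]
      have hm := neg_one_pow_mul_self m
      rw [pow_succ] at hsum ⊢
      linear_combination (-(-1 : ℂ) ^ m) * hsum - (∑ j ∈ Finset.range m, (-1 : ℂ) ^ j *
          Z.trace _ (Tot.mul (Z.R f₀) (Tot.mul (Z.totExcept c' j) (Z.D l)))) * hm

theorem exists_cyclic_cobounding (ψ : CycChain 𝒟 → ℂ) (hψ : SlotLinear ψ)
    (hbψ : ∀ t : CycChain 𝒟, t.len = m + 3 →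
      signedRot (m + 2) (hochschild (m + 1) ψ) t = hochschild (m + 1) ψ t)
    (hchar : ∀ t : CycChain 𝒟, t.len = m + 1 →
      Z.character t = cyclicNorm m (insertId m ψ) t) :
    ∃ ζ : CycChain 𝒟 → ℂ, SlotLinear ζ ∧
      (∀ t : CycChain 𝒟, t.len = m + 2 → signedRot (m + 1) ζ t = ζ t) ∧
      (∀ t : CycChain 𝒟, t.len = m + 3 →
        Z.periodicity t - ((m : ℂ) + 1) * ((m : ℂ) + 1 + 1) * hochschild (m + 1) ψ t =
          hochschild (m + 1) ζ t) := by
  obtain ⟨χ, hχ⟩ : ∃ χ : CycChain 𝒟 → ℂ, χ = fun t =>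
      ((m : ℂ) + 2) * rotPrimitive m (insertId m ψ) t := ⟨_, rfl⟩
  have hχl : SlotLinear χ := by
    rw [hχ]
    exact ((hψ.insertId m).rotPrimitive m).const_mul _
  refine ⟨fun t => Z.primitive t - ((m : ℂ) + 1) * ((m : ℂ) + 2) * ψ t - hochschild m χ t,
    (Z.slotLinear_primitive.sub (hψ.const_mul _)).sub (hχl.hochschild m), fun t ht => ?_,
    fun t ht => ?_⟩
  · have h1 := Z.primitive_sub_signedRot t ht
    have h2 := truncHochschild_insertId m ψ hbψ t ht
    have h3 := truncHochschild_sub_signedRot m χ t ht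
    have h4 : truncHochschild m (fun s => χ s - signedRot m χ s) t =
        (m + 2) * (truncHochschild m Z.character t -
          (m + 1) * truncHochschild m (insertId m ψ) t) := by
      simp only [truncHochschild, Finset.mul_sum, ← Finset.sum_sub_distrib]
      refine Finset.sum_congr rfl fun i hi => ?_
      have hl := len_face t i (by simp at hi; omega)
      have := rotPrimitive_sub_signedRot m (insertId m ψ) (face i t)
      rw [hchar _ (by omega)]
      simp only [hχ, signedRot] at this ⊢
      linear_combination (-1 : ℂ) ^ i * (m + 2) * this
    rw [h4] at h3
    simp only [signedRot] at h1 h2 h3 ⊢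
    linear_combination -h1 - (m + 1) * (m + 2) * h2 - h3
  · have h1 := hochschild_hochschild m χ t ht
    rw [← Z.hochschild_primitive t ht]
    simp only [hochschild, Finset.sum_sub_distrib, mul_sub] at h1 ⊢
    simp only [mul_left_comm _ (((m : ℂ) + 1) * (m + 2)), ← Finset.mul_sum]
    linear_combination h1

end CycleOver

end Cycle

/-- Let `n ≥ 1` and `ψ ∈ CN^n(C)` with `bψ ∈ C^{n+1}_λ(C)`.  Set
`φ := Bψ ∈ Z^{n-1}_λ(C)` and let `(S, ∂̂, T̂, ρ)` be an `(n-1)`-dimensional cycle over `C`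
whose character is `φ`.  Then `S(Bψ) = n(n+1)·bψ` in `H^{n+1}_λ(C)`: there exists
`ζ ∈ C^n_λ(C)` with `Sφ - n(n+1)·bψ = bζ`. -/
theorem S_B_psi_eq_b_psi_in_cohomology {C : Type u} [Category.{v} C] [Preadditive C]
    [CategoryTheory.Linear ℂ C] (n : ℕ) (hn : 1 ≤ n) (ψ : Cochain C)
    (hψ : IsCochain ψ)
    -- `bψ ∈ C^{n+1}_λ(C)`:
    (hbψ : ∀ t : CycChain C, t.2.size = n + 2 →
      lamOp (n + 1) (bOp n ψ) t = bOp n ψ t)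
    -- an `(n-1)`-dimensional cycle whose character is `φ = Bψ`:
    (Z : CycleOver.{u, v, u₁, v₁} C (n - 1))
    (hchar : ∀ t : CycChain C, t.2.size = n →
      charCochain Z t = BOp (n - 1) ψ t) :
    ∃ ζ : Cochain C, IsCochain ζ ∧
      (∀ t : CycChain C, t.2.size = n + 1 → lamOp n ζ t = ζ t) ∧
      (∀ t : CycChain C, t.2.size = n + 2 →
        SCochain Z t - (n : ℂ) * ((n : ℂ) + 1) * bOp n ψ t = bOp n ζ t) := by
  obtain ⟨m, rfl⟩ : ∃ m, n = m + 1 := ⟨n - 1, by omega⟩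
  obtain ⟨ζ, hζ, hcyc, hb⟩ := CycleOver.exists_cyclic_cobounding (m := m) Z ψ
    (SlotLinear.of_isCochain hψ) hbψ fun t ht => by
      obtain ⟨X, c, rfl⟩ := t.exists_eq_of
      exact (CycleOver.charCochain_of (m := m) Z c).symm.trans (hchar (CycChain.of c) ht)
  refine ⟨ζ, hζ.isCochain, hcyc, fun t ht => ?_⟩
  push_cast
  exact (congrArg (· - ((m : ℂ) + 1) * ((m : ℂ) + 1 + 1) * bOp (m + 1) ψ t)
    (CycleOver.SCochain_eq (m := m) Z t)).trans (hb t ht)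

end CFM
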